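/- arXiv:1612.03133 — 4 statements merged into one kernel-verified Lean document; each statement's English description precedes it below -/
import Mathlib

section
/- The inhomogeneous 2-chain κ = [y|x] + [yx|y] of G with ℤ₂-coefficients is a cycle, its homology class in H₂(G; ℤ₂) is nonzero, and H₂(G; ℤ₂) has exactly two elements (so the class of κ generates H₂(G;ℤ₂) ≅ ℤ₂). -/
set_option maxSynthPendingDepth 5
/-- Klein bottle group relators: the single relator `y·x·y·x⁻¹`. -/
def kbRels : Set (FreeGroup (Fin 2)) :=
  {FreeGroup.of 1 * FreeGroup.of 0 * FreeGroup.of 1 * (FreeGroup.of 0)⁻¹}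

/-- The Klein bottle group `G = ⟨x, y ∣ yxy = x⟩`. -/
abbrev KG := PresentedGroup kbRels

def kx : KG := PresentedGroup.of 0
def ky : KG := PresentedGroup.of 1

/-- The differential of the inhomogeneous (bar) chain complex of `π` with trivial
`ℤ₂`-coefficients, from `(n+1)`-chains to `n`-chains. -/
noncomputable def barD (π : Type) [Group π] (n : ℕ) :
    ((Fin (n + 1) → π) →₀ ZMod 2) →ₗ[ZMod 2] ((Fin n → π) →₀ ZMod 2) :=
  Finsupp.lsum (ZMod 2) fun g =>
    LinearMap.toSpanSingleton (ZMod 2) _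
      (Finsupp.single (fun j => g j.succ) 1
        + ∑ i : Fin n, Finsupp.single (Fin.contractNth (Fin.castSucc i) (· * ·) g) 1
        + Finsupp.single (fun j => g (Fin.castSucc j)) 1)

/-- Second group homology with trivial `ℤ₂`-coefficients (2-cycles modulo 2-boundaries). -/
noncomputable def barH2 (π : Type) [Group π] :=
  LinearMap.ker (barD π 1) ⧸
    (Submodule.comap (LinearMap.ker (barD π 1)).subtype (LinearMap.range (barD π 2)))

/-- The 2-chain `κ = [y|x] + [yx|y]`. -/
noncomputable def kappa : (Fin 2 → KG) →₀ ZMod 2 :=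
  Finsupp.single ![ky, kx] 1 + Finsupp.single ![ky * kx, ky] 1

theorem barD_one_single {π : Type} [Group π] (g h : π) :
    barD π 1 (Finsupp.single ![g, h] 1)
      = Finsupp.single ![h] 1 + Finsupp.single ![g * h] 1 + Finsupp.single ![g] 1 := by
  have h₀ : (fun j : Fin 1 => (![g, h] : Fin 2 → π) j.succ) = ![h] := by
    ext j; fin_cases j; rfl
  have h₁ : Fin.contractNth (Fin.castSucc (0 : Fin 1)) (· * ·) ![g, h] = ![g * h] := by
    ext j; fin_cases j; rfl
  have h₂ : (fun j : Fin 1 => (![g, h] : Fin 2 → π) (Fin.castSucc j)) = ![g] := by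
    ext j; fin_cases j; rfl
  simp only [barD, Finsupp.lsum_single, LinearMap.toSpanSingleton_apply, one_smul,
    Fin.sum_univ_one, h₀, h₁, h₂]

theorem barD_two_single {π : Type} [Group π] (g h k : π) :
    barD π 2 (Finsupp.single ![g, h, k] 1)
      = Finsupp.single ![h, k] 1 + (Finsupp.single ![g * h, k] 1 + Finsupp.single ![g, h * k] 1)
        + Finsupp.single ![g, h] 1 := by
  have h₀ : (fun j : Fin 2 => (![g, h, k] : Fin 3 → π) j.succ) = ![h, k] := by
    ext j; fin_cases j <;> rfl
  have h₁ : Fin.contractNth (Fin.castSucc (0 : Fin 2)) (· * ·) ![g, h, k] = ![g * h, k] := by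
    ext j; fin_cases j <;> rfl
  have h₂ : Fin.contractNth (Fin.castSucc (1 : Fin 2)) (· * ·) ![g, h, k] = ![g, h * k] := by
    ext j; fin_cases j <;> rfl
  have h₃ : (fun j : Fin 2 => (![g, h, k] : Fin 3 → π) (Fin.castSucc j)) = ![g, h] := by
    ext j; fin_cases j <;> rfl
  simp only [barD, Finsupp.lsum_single, LinearMap.toSpanSingleton_apply, one_smul,
    Fin.sum_univ_two, h₀, h₁, h₂, h₃]

/-- Two `ZMod 2`-linear maps on `2`-chains agree if they agree on all `[g|h]`. -/
theorem chains_two_hom_ext {π M : Type} [AddCommMonoid M] [Module (ZMod 2) M]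
    {F F' : ((Fin 2 → π) →₀ ZMod 2) →ₗ[ZMod 2] M}
    (hF : ∀ g h, F (Finsupp.single ![g, h] 1) = F' (Finsupp.single ![g, h] 1)) : F = F' := by
  refine Finsupp.lhom_ext' fun v => LinearMap.ext_ring ?_
  have hv : v = ![v 0, v 1] := by ext j; fin_cases j <;> rfl
  rw [hv]
  exact hF _ _

theorem chains_three_hom_ext {π M : Type} [AddCommMonoid M] [Module (ZMod 2) M]
    {F F' : ((Fin 3 → π) →₀ ZMod 2) →ₗ[ZMod 2] M}
    (hF : ∀ g h k, F (Finsupp.single ![g, h, k] 1) = F' (Finsupp.single ![g, h, k] 1)) :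
    F = F' := by
  refine Finsupp.lhom_ext' fun v => LinearMap.ext_ring ?_
  have hv : v = ![v 0, v 1, v 2] := by ext j; fin_cases j <;> rfl
  rw [hv]
  exact hF _ _ _

/-- An inhomogeneous `2`-cocycle with values in the trivial module `ZMod 2`. -/
structure ModTwoCocycle (π : Type) [Group π] where
  /-- The underlying function. -/
  val : π → π → ZMod 2
  cocycle : ∀ g h k, val h k + (val (g * h) k + val g (h * k)) + val g h = 0

namespace ModTwoCocycle

variable {π : Type} [Group π] (f : ModTwoCocycle π)

/-- The central extension of `π` by `ZMod 2` determined by a `2`-cocycle. -/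
@[ext]
structure Extension (f : ModTwoCocycle π) where
  /-- The central coordinate. -/
  coeff : ZMod 2
  /-- The projection to `π`. -/
  proj : π

theorem val_one_left (g : π) : f.val 1 g = f.val 1 1 := by
  have h := f.cocycle 1 1 g
  simp only [one_mul] at h
  generalize f.val 1 g = a at *
  generalize f.val 1 1 = b at *
  revert a b
  decide

instance : Mul f.Extension :=
  ⟨fun a b => ⟨a.coeff + b.coeff + f.val a.proj b.proj, a.proj * b.proj⟩⟩

instance : One f.Extension := ⟨⟨f.val 1 1, 1⟩⟩

instance : Inv f.Extension :=
  ⟨fun a => ⟨a.coeff + f.val a.proj⁻¹ a.proj + f.val 1 1, a.proj⁻¹⟩⟩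

@[simp]
theorem coeff_mul (a b : f.Extension) :
    (a * b).coeff = a.coeff + b.coeff + f.val a.proj b.proj := rfl

@[simp]
theorem proj_mul (a b : f.Extension) : (a * b).proj = a.proj * b.proj := rfl

@[simp]
theorem coeff_one : (1 : f.Extension).coeff = f.val 1 1 := rfl

@[simp]
theorem proj_one : (1 : f.Extension).proj = 1 := rfl

@[simp]
theorem coeff_inv (a : f.Extension) :
    a⁻¹.coeff = a.coeff + f.val a.proj⁻¹ a.proj + f.val 1 1 := rfl

@[simp]
theorem proj_inv (a : f.Extension) : a⁻¹.proj = a.proj⁻¹ := rfl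

instance : Group f.Extension :=
  Group.ofLeftAxioms
    (fun a b c => by
      ext
      · have h := f.cocycle a.proj b.proj c.proj
        simp only [coeff_mul, proj_mul]
        grind
      · simp [mul_assoc])
    (fun a => by
      ext
      · simp only [coeff_mul, coeff_one, proj_one, val_one_left]
        grind
      · simp)
    (fun a => by
      ext
      · simp only [coeff_mul, coeff_inv, proj_inv, coeff_one]
        grind
      · simp)

/-- The projection of the central extension onto `π`. -/
def projHom : f.Extension →* π where
  toFun := Extension.proj
  map_one' := rfl
  map_mul' _ _ := rfl

/-- A functional on `2`-chains vanishing on boundaries is a `2`-cocycle. -/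
noncomputable def ofFunctional (F : ((Fin 2 → π) →₀ ZMod 2) →ₗ[ZMod 2] ZMod 2) (hF : F ∘ₗ barD π 2 = 0) :
    ModTwoCocycle π where
  val g h := F (Finsupp.single ![g, h] 1)
  cocycle g h k := by
    have := LinearMap.congr_fun hF (Finsupp.single ![g, h, k] 1)
    simpa only [LinearMap.comp_apply, barD_two_single, map_add,
      LinearMap.zero_apply] using this

end ModTwoCocycle

theorem ky_mul_kx_mul_ky : ky * kx * ky = kx := by
  have h : PresentedGroup.mk kbRels
      (FreeGroup.of 1 * FreeGroup.of 0 * FreeGroup.of 1 * (FreeGroup.of 0)⁻¹) = 1 :=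
    PresentedGroup.one_of_mem rfl
  rw [map_mul, map_inv, mul_inv_eq_one] at h
  simp only [map_mul] at h
  exact h

/-- The homomorphism out of the Klein bottle group determined by a pair `a`, `b` with
`b * a * b = a`. -/
def KG.lift {H : Type} [Group H] (a b : H) (hab : b * a * b = a) : KG →* H :=
  PresentedGroup.toGroup (f := ![a, b]) (by
    rintro r rfl
    simp [hab])

@[simp]
theorem KG.lift_kx {H : Type} [Group H] (a b : H) (hab : b * a * b = a) :
    KG.lift a b hab kx = a :=
  PresentedGroup.toGroup.of _

@[simp]
theorem KG.lift_ky {H : Type} [Group H] (a b : H) (hab : b * a * b = a) :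
    KG.lift a b hab ky = b :=
  PresentedGroup.toGroup.of _

theorem KG.hom_ext {H : Type} [Group H] {φ ψ : KG →* H} (hx : φ kx = ψ kx) (hy : φ ky = ψ ky) :
    φ = ψ :=
  PresentedGroup.ext fun i => by fin_cases i <;> assumption

/-- A `2`-cocycle on the Klein bottle group that vanishes on `κ` is a coboundary: its central
extension splits. -/
theorem ModTwoCocycle.exists_coboundary (f : ModTwoCocycle KG)
    (hf : f.val ky kx + f.val (ky * kx) ky = 0) :
    ∃ s : KG → ZMod 2, ∀ g h, f.val g h = s h + s (g * h) + s g := by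
  let σ : KG →* f.Extension := KG.lift ⟨0, kx⟩ ⟨0, ky⟩ (by
    ext
    · simpa using hf
    · exact ky_mul_kx_mul_ky)
  have hσ : f.projHom.comp σ = MonoidHom.id KG :=
    KG.hom_ext (by simp [σ, projHom]) (by simp [σ, projHom])
  have hproj (g : KG) : (σ g).proj = g := DFunLike.congr_fun hσ g
  refine ⟨fun g => (σ g).coeff, fun g h => ?_⟩
  simp only [map_mul, coeff_mul, hproj]
  grind

theorem functional_eq_zero_of_mem_ker (F : ((Fin 2 → KG) →₀ ZMod 2) →ₗ[ZMod 2] ZMod 2)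
    (hF : F ∘ₗ barD KG 2 = 0) (hκ : F kappa = 0) {z : (Fin 2 → KG) →₀ ZMod 2}
    (hz : barD KG 1 z = 0) : F z = 0 := by
  obtain ⟨s, hs⟩ := (ModTwoCocycle.ofFunctional F hF).exists_coboundary (by
    simpa [ModTwoCocycle.ofFunctional, kappa] using hκ)
  have hFs : F = (Finsupp.lsum (ZMod 2) fun v : Fin 1 → KG =>
      LinearMap.toSpanSingleton (ZMod 2) (ZMod 2) (s (v 0))) ∘ₗ barD KG 1 := by
    refine chains_two_hom_ext fun g h => ?_
    rw [LinearMap.comp_apply, barD_one_single]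
    simpa [ModTwoCocycle.ofFunctional, -Finsupp.coe_lsum,
      Finsupp.lsum_single] using hs g h
  rw [hFs, LinearMap.comp_apply, hz, map_zero]

/-- Every `2`-cycle of the Klein bottle group is homologous to a multiple of `κ`. -/
theorem ker_barD_one_le : LinearMap.ker (barD KG 1) ≤
    LinearMap.range (barD KG 2) ⊔ Submodule.span (ZMod 2) {kappa} := by
  intro z hz
  by_contra hmem
  obtain ⟨F, hFz, hF⟩ := Submodule.exists_le_ker_of_notMem hmem
  refine hFz (functional_eq_zero_of_mem_ker F ?_ ?_ hz)
  · ext1 v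
    ext
    exact hF (Submodule.mem_sup_left (LinearMap.mem_range_self _ _))
  · exact hF (Submodule.mem_sup_right (Submodule.mem_span_singleton_self _))

theorem barD_one_kappa : barD KG 1 kappa = 0 := by
  rw [kappa, map_add, barD_one_single, barD_one_single, ky_mul_kx_mul_ky]
  have h2 (c : (Fin 1 → KG) →₀ ZMod 2) : c + c = 0 := ZModModule.add_self c
  generalize Finsupp.single ![kx] (1 : ZMod 2) = a
  generalize Finsupp.single ![ky] (1 : ZMod 2) = b
  generalize Finsupp.single ![ky * kx] (1 : ZMod 2) = c
  calc a + c + b + (b + a + c) = (a + a) + (b + b) + (c + c) := by abel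
    _ = 0 := by simp only [h2]

/-- The cup product of two homomorphisms to `ZMod 2`, as a functional on `2`-chains. -/
noncomputable def cupFunctional {π : Type} [Group π] (a b : π →* Multiplicative (ZMod 2)) :
    ((Fin 2 → π) →₀ ZMod 2) →ₗ[ZMod 2] ZMod 2 :=
  Finsupp.lsum (ZMod 2) fun v =>
    LinearMap.toSpanSingleton (ZMod 2) (ZMod 2) ((a (v 0)).toAdd * (b (v 1)).toAdd)

theorem cupFunctional_comp_barD {π : Type} [Group π] (a b : π →* Multiplicative (ZMod 2)) :
    cupFunctional a b ∘ₗ barD π 2 = 0 := by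
  refine chains_three_hom_ext fun g h k => ?_
  rw [LinearMap.comp_apply, barD_two_single]
  simp only [cupFunctional, map_add, Finsupp.lsum_single, LinearMap.toSpanSingleton_apply,
    one_smul, Matrix.cons_val_zero, Matrix.cons_val_one, map_mul, toAdd_mul, LinearMap.zero_apply]
  grind

theorem kappa_notMem_range : kappa ∉ Set.range (barD KG 2) := by
  let t : Multiplicative (ZMod 2) := Multiplicative.ofAdd 1
  let a : KG →* Multiplicative (ZMod 2) := KG.lift t 1 (by decide)
  let b : KG →* Multiplicative (ZMod 2) := KG.lift 1 t (by decide)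
  rintro ⟨w, hw⟩
  have h0 : cupFunctional a b kappa = 0 := by
    rw [← hw]
    exact LinearMap.congr_fun (cupFunctional_comp_barD a b) w
  simp [cupFunctional, kappa, a, b, t, -Finsupp.coe_lsum,
    Finsupp.lsum_single] at h0

/-- `κ` is a cycle, is not a boundary (so its homology class is nonzero), and
`H₂(G;ℤ₂)` has exactly two elements. -/
theorem stmt7 :
    barD KG 1 kappa = 0 ∧ kappa ∉ Set.range (barD KG 2) ∧ Nat.card (barH2 KG) = 2 := by
  refine ⟨barD_one_kappa, kappa_notMem_range, ?_⟩
  unfold barH2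
  rw [Nat.card_eq_two_iff]
  refine ⟨0, Submodule.Quotient.mk ⟨kappa, barD_one_kappa⟩, fun h => ?_, ?_⟩
  · exact kappa_notMem_range ((Submodule.Quotient.mk_eq_zero _).1 h.symm)
  · refine Set.eq_univ_of_forall fun q => ?_
    obtain ⟨⟨z, hz⟩, rfl⟩ := Submodule.Quotient.mk_surjective _ q
    obtain ⟨u, hu, v, hv, huv⟩ := Submodule.mem_sup.1 (ker_barD_one_le hz)
    obtain ⟨c, rfl⟩ := Submodule.mem_span_singleton.1 hv
    obtain rfl | rfl : c = 0 ∨ c = 1 := by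
      clear hv huv; revert c; decide
    · left
      refine (Submodule.Quotient.mk_eq_zero _).2 ?_
      rw [zero_smul, add_zero] at huv
      exact huv ▸ hu
    · right
      refine (Submodule.Quotient.eq _).2 ?_
      rw [one_smul] at huv
      rw [eq_sub_of_add_eq huv] at hu
      exact hu
end

section
/- The map ℤ × ZMod 2 → D sending (n, 0) ↦ yⁿ and (n, 1) ↦ yⁿx is a bijection; in particular every element of D is uniquely of the form yⁿ or yⁿx with n ∈ ℤ. -/
/-- Relators of the infinite dihedral group: `y·x·y·x⁻¹` and `x²`. -/
def dihRels : Set (FreeGroup (Fin 2)) :=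
  {FreeGroup.of 1 * FreeGroup.of 0 * FreeGroup.of 1 * (FreeGroup.of 0)⁻¹,
   FreeGroup.of 0 ^ 2}

/-- The infinite dihedral group `D = ⟨x, y ∣ yxy = x, x² = 1⟩`. -/
abbrev DG := PresentedGroup dihRels

def dx : DG := PresentedGroup.of 0
def dy : DG := PresentedGroup.of 1

/-- The map `(n,0) ↦ yⁿ`, `(n,1) ↦ yⁿx`. -/
def dihEnum (p : ℤ × ZMod 2) : DG := dy ^ p.1 * dx ^ (p.2.val)

theorem ZMod.two_eq_zero_or_one : ∀ i : ZMod 2, i = 0 ∨ i = 1 := by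
  decide

theorem dx_sq : dx ^ 2 = 1 :=
  PresentedGroup.one_of_mem (rels := dihRels) (Or.inr rfl)

theorem dy_mul_dx_mul_dy : dy * dx * dy = dx :=
  mul_inv_eq_one.mp (PresentedGroup.one_of_mem (rels := dihRels) (Or.inl rfl))

theorem dx_inv : dx⁻¹ = dx :=
  inv_eq_of_mul_eq_one_left (by rw [← sq, dx_sq])

theorem dx_mul_dy_zpow (n : ℤ) : dx * dy ^ n = dy ^ (-n) * dx := by
  have h : SemiconjBy dx dy dy⁻¹ := by
    rw [SemiconjBy, eq_inv_mul_iff_mul_eq, ← mul_assoc, dy_mul_dx_mul_dy]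
  simpa using (h.zpow_right n).eq

theorem dihEnum_zero (n : ℤ) : dihEnum (n, 0) = dy ^ n := by
  simp [dihEnum]

theorem dihEnum_one (n : ℤ) : dihEnum (n, 1) = dy ^ n * dx := by
  simp [dihEnum, ZMod.val_one]

theorem dy_zpow_mul_dihEnum (k n : ℤ) (i : ZMod 2) :
    dy ^ k * dihEnum (n, i) = dihEnum (k + n, i) := by
  simp only [dihEnum, zpow_add, mul_assoc]

theorem dx_mul_dihEnum (n : ℤ) (i : ZMod 2) :
    dx * dihEnum (n, i) = dihEnum (-n, i + 1) := by
  obtain rfl | rfl := ZMod.two_eq_zero_or_one i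
  · rw [zero_add, dihEnum_zero, dihEnum_one, dx_mul_dy_zpow]
  · rw [show (1 + 1 : ZMod 2) = 0 from rfl, dihEnum_zero, dihEnum_one, ← mul_assoc,
      dx_mul_dy_zpow, mul_assoc, ← sq, dx_sq, mul_one]

theorem dihEnum_surjective : Function.Surjective dihEnum := by
  intro g
  have hg : g ∈ Subgroup.closure (Set.range (PresentedGroup.of (rels := dihRels))) := by
    rw [PresentedGroup.closure_range_of]
    trivial
  induction hg using Subgroup.closure_induction_left with
  | one => exact ⟨(0, 0), by simp [dihEnum]⟩
  | mul_left a ha b _ ih =>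
    obtain ⟨j, rfl⟩ := ha
    obtain ⟨⟨n, i⟩, rfl⟩ := ih
    fin_cases j
    · exact ⟨_, (dx_mul_dihEnum n i).symm⟩
    · exact ⟨(1 + n, i), by rw [← dy_zpow_mul_dihEnum, zpow_one]; rfl⟩
  | inv_mul_cancel a ha b _ ih =>
    obtain ⟨j, rfl⟩ := ha
    obtain ⟨⟨n, i⟩, rfl⟩ := ih
    fin_cases j
    · exact ⟨(-n, i + 1), by rw [← dx_mul_dihEnum, ← dx_inv]; rfl⟩
    · exact ⟨(-1 + n, i), by rw [← dy_zpow_mul_dihEnum, zpow_neg_one]; rfl⟩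

/-- The homomorphism from `D` to Mathlib's infinite dihedral group with `x ↦ sr 0`, `y ↦ r 1`. -/
def toDihedralGroup : DG →* DihedralGroup 0 :=
  PresentedGroup.toGroup (f := ![DihedralGroup.sr 0, DihedralGroup.r 1]) (by
    rintro _ (rfl | rfl) <;> simp [sq])

theorem toDihedralGroup_dx : toDihedralGroup dx = DihedralGroup.sr 0 :=
  PresentedGroup.toGroup.of _

theorem toDihedralGroup_dy : toDihedralGroup dy = DihedralGroup.r 1 :=
  PresentedGroup.toGroup.of _

theorem toDihedralGroup_dihEnum_zero (n : ℤ) :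
    toDihedralGroup (dihEnum (n, 0)) = DihedralGroup.r n := by
  rw [dihEnum_zero, map_zpow, toDihedralGroup_dy, DihedralGroup.r_one_zpow]
  rfl

theorem toDihedralGroup_dihEnum_one (n : ℤ) :
    toDihedralGroup (dihEnum (n, 1)) = DihedralGroup.sr (-n) := by
  rw [dihEnum_one, map_mul, map_zpow, toDihedralGroup_dx, toDihedralGroup_dy,
    DihedralGroup.r_one_zpow, DihedralGroup.r_mul_sr, zero_sub]
  rfl

theorem dihEnum_injective : Function.Injective dihEnum := by
  rintro ⟨m, i⟩ ⟨n, j⟩ h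
  have himage := congrArg toDihedralGroup h
  obtain rfl | rfl := ZMod.two_eq_zero_or_one i
  all_goals
    obtain rfl | rfl := ZMod.two_eq_zero_or_one j
    all_goals
      simp only [toDihedralGroup_dihEnum_zero, toDihedralGroup_dihEnum_one, reduceCtorEq] at himage
  · exact congrArg (·, 0) (DihedralGroup.r.inj himage)
  · exact congrArg (·, 1) (neg_injective (DihedralGroup.sr.inj himage))

/-- Every element of `D` is uniquely of the form `yⁿ` or `yⁿx` with `n ∈ ℤ`. -/
theorem stmt17 : Function.Bijective dihEnum :=
  ⟨dihEnum_injective, dihEnum_surjective⟩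
end

section
/- For every g ≥ 2, the second group homology H₂(π_g; ℤ₂) with trivial ℤ₂-coefficients has exactly two elements, i.e. H₂(π_g; ℤ₂) ≅ ℤ₂. -/
set_option maxSynthPendingDepth 5

/-- Relators of the non-orientable surface group of genus `g`:
the single relator `a₁²a₂²⋯a_g²`. -/
def surfRels (g : ℕ) : Set (FreeGroup (Fin g)) :=
  {(List.ofFn fun i : Fin g => FreeGroup.of i ^ 2).prod}

/-- The fundamental group `π_g = ⟨a₁,…,a_g ∣ a₁²⋯a_g² = 1⟩` of the closed
non-orientable surface of genus `g`. -/
abbrev SG (g : ℕ) := PresentedGroup (surfRels g)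

/-- A normalisation-free `2`-cocycle of `G` with values in the trivial module `Q`. -/
structure TrivialTwoCocycle (G Q : Type) [Group G] [AddCommGroup Q] where
  /-- The underlying function. -/
  val : G → G → Q
  cocycle : ∀ x y z, val y z + val x (y * z) = val (x * y) z + val x y

/-- The central extension of `G` by `Q` defined by a `2`-cocycle. -/
@[ext]
structure CocycleExtension {G Q : Type} [Group G] [AddCommGroup Q]
    (f : TrivialTwoCocycle G Q) where
  /-- The component in the quotient group. -/
  base : G
  /-- The component in the central subgroup. -/
  fiber : Q

namespace CocycleExtension

variable {G Q : Type} [Group G] [AddCommGroup Q] (f : TrivialTwoCocycle G Q)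

instance : Mul (CocycleExtension f) :=
  ⟨fun p q => ⟨p.base * q.base, p.fiber + q.fiber + f.val p.base q.base⟩⟩

instance : One (CocycleExtension f) := ⟨⟨1, -f.val 1 1⟩⟩

instance : Inv (CocycleExtension f) :=
  ⟨fun p => ⟨p.base⁻¹, -p.fiber - f.val p.base⁻¹ p.base - f.val 1 1⟩⟩

variable {f}

@[simp] theorem base_mul (p q : CocycleExtension f) : (p * q).base = p.base * q.base := rfl

@[simp] theorem fiber_mul (p q : CocycleExtension f) :
    (p * q).fiber = p.fiber + q.fiber + f.val p.base q.base := rfl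

@[simp] theorem base_one : (1 : CocycleExtension f).base = 1 := rfl

@[simp] theorem fiber_one : (1 : CocycleExtension f).fiber = -f.val 1 1 := rfl

@[simp] theorem base_inv (p : CocycleExtension f) : p⁻¹.base = p.base⁻¹ := rfl

@[simp] theorem fiber_inv (p : CocycleExtension f) :
    p⁻¹.fiber = -p.fiber - f.val p.base⁻¹ p.base - f.val 1 1 := rfl

instance : Group (CocycleExtension f) :=
  Group.ofLeftAxioms
    (by
      intro p q r
      ext
      · simp [mul_assoc]
      · have h := f.cocycle p.base q.base r.base
        simp only [fiber_mul, base_mul]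
        linear_combination (norm := module) -h)
    (by
      intro p
      ext
      · simp
      · have h := f.cocycle 1 1 p.base
        simp only [one_mul, add_right_inj] at h
        simp [h])
    (by
      intro p
      ext
      · simp
      · simp only [fiber_mul, fiber_inv, fiber_one, base_inv]
        abel)

/-- The projection of the extension onto `G`. -/
def proj : CocycleExtension f →* G where
  toFun := base
  map_one' := rfl
  map_mul' _ _ := rfl

end CocycleExtension

section BarComplex

variable {G : Type} [Group G]

theorem barD_one_single_s18 (x y : G) :
    barD G 1 (Finsupp.single ![x, y] 1) =
      Finsupp.single ![y] 1 + Finsupp.single ![x * y] 1 + Finsupp.single ![x] 1 := by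
  have h₁ : (fun j : Fin 1 => ![x, y] j.succ) = ![y] := by
    funext j; fin_cases j; rfl
  have h₂ : Fin.contractNth (Fin.castSucc (0 : Fin 1)) (· * ·) ![x, y] = ![x * y] := by
    funext j; fin_cases j; rfl
  have h₃ : (fun j : Fin 1 => ![x, y] (Fin.castSucc j)) = ![x] := by
    funext j; fin_cases j; rfl
  simp only [barD, Finsupp.lsum_single, LinearMap.toSpanSingleton_apply, one_smul,
    Fin.sum_univ_one, h₁, h₂, h₃]

theorem barD_two_single_s18 (x y z : G) :
    barD G 2 (Finsupp.single ![x, y, z] 1) =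
      Finsupp.single ![y, z] 1 + (Finsupp.single ![x * y, z] 1 + Finsupp.single ![x, y * z] 1) +
        Finsupp.single ![x, y] 1 := by
  have h₁ : (fun j : Fin 2 => ![x, y, z] j.succ) = ![y, z] := by
    funext j; fin_cases j <;> rfl
  have h₂ : Fin.contractNth (Fin.castSucc (0 : Fin 2)) (· * ·) ![x, y, z] = ![x * y, z] := by
    funext j; fin_cases j <;> rfl
  have h₃ : Fin.contractNth (Fin.castSucc (1 : Fin 2)) (· * ·) ![x, y, z] = ![x, y * z] := by
    funext j; fin_cases j <;> rfl
  have h₄ : (fun j : Fin 2 => ![x, y, z] (Fin.castSucc j)) = ![x, y] := by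
    funext j; fin_cases j <;> rfl
  simp only [barD, Finsupp.lsum_single, LinearMap.toSpanSingleton_apply, one_smul,
    Fin.sum_univ_two, h₁, h₂, h₃, h₄]

/-- The `2`-chain filling the product of squares of the entries of a list. -/
noncomputable def squaresChain : List G → ((Fin 2 → G) →₀ ZMod 2)
  | [] => 0
  | x :: l => Finsupp.single ![x, x] 1 + Finsupp.single ![x ^ 2, (l.map (· ^ 2)).prod] 1 +
      squaresChain l

theorem barD_squaresChain (l : List G) :
    barD G 1 (squaresChain l) =
      Finsupp.single ![(l.map (· ^ 2)).prod] 1 + Finsupp.single ![1] 1 := by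
  induction l with
  | nil => simp [squaresChain, ZModModule.add_self]
  | cons x l ih =>
    simp only [squaresChain, map_add, barD_one_single_s18, ih, List.map_cons, List.prod_cons, ← sq]
    set p : (Fin 1 → G) →₀ ZMod 2 := Finsupp.single ![(l.map (· ^ 2)).prod] 1
    have h₁ := ZModModule.add_self p
    have h₂ := ZModModule.add_self (Finsupp.single ![x] 1 : (Fin 1 → G) →₀ ZMod 2)
    have h₃ := ZModModule.add_self (Finsupp.single ![x ^ 2] 1 : (Fin 1 → G) →₀ ZMod 2)
    linear_combination (norm := module) h₁ + h₂ + h₃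

/-- The cup square of a homomorphism `G → ℤ₂`, as a functional on `2`-chains. -/
noncomputable def cupSquare (φ : G →* Multiplicative (ZMod 2)) :
    ((Fin 2 → G) →₀ ZMod 2) →ₗ[ZMod 2] ZMod 2 :=
  Finsupp.lsum (ZMod 2) fun v =>
    LinearMap.toSpanSingleton (ZMod 2) _ ((φ (v 0)).toAdd * (φ (v 1)).toAdd)

theorem cupSquare_single (φ : G →* Multiplicative (ZMod 2)) (x y : G) :
    cupSquare φ (Finsupp.single ![x, y] 1) = (φ x).toAdd * (φ y).toAdd := by
  simp [cupSquare]

theorem cupSquare_barD (φ : G →* Multiplicative (ZMod 2)) (w : (Fin 3 → G) →₀ ZMod 2) :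
    cupSquare φ (barD G 2 w) = 0 := by
  suffices h : cupSquare φ ∘ₗ barD G 2 = 0 from LinearMap.congr_fun h w
  refine Finsupp.lhom_ext' fun v => LinearMap.ext_ring ?_
  obtain ⟨x, y, z, rfl⟩ : ∃ x y z, v = ![x, y, z] :=
    ⟨v 0, v 1, v 2, by funext j; fin_cases j <;> rfl⟩
  simp only [LinearMap.comp_apply, Finsupp.lsingle_apply, barD_two_single_s18, map_add,
    cupSquare_single, map_mul, toAdd_mul, LinearMap.zero_apply]
  generalize (φ x).toAdd = a
  generalize (φ y).toAdd = b
  generalize (φ z).toAdd = c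
  revert a b c
  decide

theorem cupSquare_squaresChain (φ : G →* Multiplicative (ZMod 2)) (l : List G) :
    cupSquare φ (squaresChain l) = (l.map fun x => (φ x).toAdd).sum := by
  induction l with
  | nil => simp [squaresChain]
  | cons x l ih =>
    simp only [squaresChain, map_add, cupSquare_single, ih, List.map_cons, List.sum_cons, map_pow,
      toAdd_pow]
    generalize (φ x).toAdd = a
    have h : ∀ a : ZMod 2, a * a = a ∧ 2 • a = 0 := by decide
    rw [(h a).1, (h a).2]
    ring

/-- A linear map out of `2`-chains that kills boundaries, viewed as a cocycle. -/
noncomputable def cocycleOfLinearMap {Q : Type} [AddCommGroup Q] [Module (ZMod 2) Q]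
    (q : ((Fin 2 → G) →₀ ZMod 2) →ₗ[ZMod 2] Q) (hq : ∀ w, q (barD G 2 w) = 0) :
    TrivialTwoCocycle G Q where
  val x y := q (Finsupp.single ![x, y] 1)
  cocycle x y z := by
    have h := hq (Finsupp.single ![x, y, z] 1)
    simp only [barD_two_single_s18, map_add] at h
    have h₁ := ZModModule.add_self (q (Finsupp.single ![x * y, z] 1))
    have h₂ := ZModModule.add_self (q (Finsupp.single ![x, y] 1))
    linear_combination (norm := module) h - h₁ - h₂

theorem cocycleOfLinearMap_val {Q : Type} [AddCommGroup Q] [Module (ZMod 2) Q]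
    (q : ((Fin 2 → G) →₀ ZMod 2) →ₗ[ZMod 2] Q) (hq : ∀ w, q (barD G 2 w) = 0) (x y : G) :
    (cocycleOfLinearMap q hq).val x y = q (Finsupp.single ![x, y] 1) := rfl

theorem prod_map_lift_sq {Q : Type} [AddCommGroup Q] [Module (ZMod 2) Q]
    (q : ((Fin 2 → G) →₀ ZMod 2) →ₗ[ZMod 2] Q) (hq : ∀ w, q (barD G 2 w) = 0) (l : List G) :
    (l.map fun x => (⟨x, 0⟩ : CocycleExtension (cocycleOfLinearMap q hq)) ^ 2).prod =
      ⟨(l.map (· ^ 2)).prod, q (squaresChain l) - q (Finsupp.single ![1, 1] 1)⟩ := by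
  induction l with
  | nil => ext <;> simp [squaresChain, cocycleOfLinearMap_val]
  | cons x l ih =>
    rw [List.map_cons, List.prod_cons, ih]
    ext
    · simp [sq]
    · simp only [sq, squaresChain, cocycleOfLinearMap_val, map_add, CocycleExtension.fiber_mul,
        CocycleExtension.base_mul]
      abel

end BarComplex

section SurfaceGroup

/-- The list of standard generators of `π_g`. -/
def surfGens (g : ℕ) : List (SG g) := List.ofFn fun i : Fin g => PresentedGroup.of i

theorem lift_eq_one_of_mem_surfRels {H : Type} [Group H] {g : ℕ} (s : Fin g → H)
    (hs : (List.ofFn fun i => s i ^ 2).prod = 1) : ∀ r ∈ surfRels g, FreeGroup.lift s r = 1 := by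
  rintro r rfl
  rw [map_list_prod, List.map_ofFn, ← hs]
  congr 2
  funext i
  simp

theorem prod_surfGens_sq (g : ℕ) : ((surfGens g).map (· ^ 2)).prod = 1 := by
  have h : PresentedGroup.mk (surfRels g)
      (List.ofFn fun i : Fin g => FreeGroup.of i ^ 2).prod = 1 :=
    PresentedGroup.one_of_mem rfl
  rw [map_list_prod, List.map_ofFn] at h
  rw [surfGens, List.map_ofFn, ← h]
  congr 2

theorem barD_squaresChain_surfGens (g : ℕ) : barD (SG g) 1 (squaresChain (surfGens g)) = 0 := by
  rw [barD_squaresChain, prod_surfGens_sq, ZModModule.add_self]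

/-- A functional killing boundaries and the surface cycle kills every cycle. -/
theorem map_eq_zero_of_cycle {g : ℕ} {Q : Type} [AddCommGroup Q] [Module (ZMod 2) Q]
    (q : ((Fin 2 → SG g) →₀ ZMod 2) →ₗ[ZMod 2] Q) (hq : ∀ w, q (barD (SG g) 2 w) = 0)
    (hz : q (squaresChain (surfGens g)) = 0) {w : (Fin 2 → SG g) →₀ ZMod 2}
    (hw : barD (SG g) 1 w = 0) : q w = 0 := by
  let s : Fin g → CocycleExtension (cocycleOfLinearMap q hq) := fun i => ⟨PresentedGroup.of i, 0⟩
  have hs : (List.ofFn fun i => s i ^ 2).prod = 1 := by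
    have h := prod_map_lift_sq q hq (surfGens g)
    rw [prod_surfGens_sq, hz, zero_sub, surfGens, List.map_ofFn] at h
    exact h
  let σ : SG g →* CocycleExtension (cocycleOfLinearMap q hq) :=
    PresentedGroup.toGroup (lift_eq_one_of_mem_surfRels s hs)
  have hσ : ∀ x, (σ x).base = x := by
    have h : CocycleExtension.proj.comp σ = MonoidHom.id _ := by
      refine PresentedGroup.ext fun i => ?_
      simp [σ, s, CocycleExtension.proj]
    exact fun x => DFunLike.congr_fun h x
  let h : ((Fin 1 → SG g) →₀ ZMod 2) →ₗ[ZMod 2] Q :=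
    Finsupp.lsum (ZMod 2) fun v => LinearMap.toSpanSingleton (ZMod 2) _ (σ (v 0)).fiber
  have hh : h ∘ₗ barD (SG g) 1 = q := by
    refine Finsupp.lhom_ext' fun v => LinearMap.ext_ring ?_
    obtain ⟨x, y, rfl⟩ : ∃ x y, v = ![x, y] := ⟨v 0, v 1, by funext j; fin_cases j <;> rfl⟩
    have hsingle : ∀ x, h (Finsupp.single ![x] 1) = (σ x).fiber := fun x => by simp [h]
    simp only [LinearMap.comp_apply, Finsupp.lsingle_apply, barD_one_single_s18, map_add, hsingle,
      map_mul, CocycleExtension.fiber_mul, hσ]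
    have h₁ := ZModModule.add_self (σ x).fiber
    have h₂ := ZModModule.add_self (σ y).fiber
    simp only [cocycleOfLinearMap_val]
    linear_combination (norm := module) h₁ + h₂
  rw [← hh, LinearMap.comp_apply, hw, map_zero]

theorem exists_cupSquare_surfGens_eq_one {g : ℕ} (hg : 0 < g) :
    ∃ φ : SG g →* Multiplicative (ZMod 2), cupSquare φ (squaresChain (surfGens g)) = 1 := by
  let s : Fin g → Multiplicative (ZMod 2) :=
    fun i => Multiplicative.ofAdd (if i = ⟨0, hg⟩ then 1 else 0)
  have hsq : ∀ a : Multiplicative (ZMod 2), a ^ 2 = 1 := by decide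
  have hs : (List.ofFn fun i => s i ^ 2).prod = 1 := by
    simp [hsq]
  refine ⟨PresentedGroup.toGroup (lift_eq_one_of_mem_surfRels s hs), ?_⟩
  rw [cupSquare_squaresChain, surfGens, List.map_ofFn, List.sum_ofFn]
  simp [s]

end SurfaceGroup

/-- For every `g ≥ 2`, `H₂(π_g;ℤ₂)` has exactly two elements. -/
theorem stmt18 (g : ℕ) (hg : 2 ≤ g) : Nat.card (barH2 (SG g)) = 2 := by
  unfold barH2
  let z : LinearMap.ker (barD (SG g) 1) :=
    ⟨squaresChain (surfGens g), barD_squaresChain_surfGens g⟩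
  rw [Nat.card_eq_two_iff]
  refine ⟨0, Submodule.Quotient.mk z, ?_, ?_⟩
  · obtain ⟨φ, hφ⟩ := exists_cupSquare_surfGens_eq_one (g := g) (by omega)
    intro h
    obtain ⟨w, hw⟩ := (Submodule.Quotient.mk_eq_zero _).1 h.symm
    have h₀ := cupSquare_barD φ w
    rw [hw] at h₀
    exact one_ne_zero (hφ.symm.trans h₀)
  · refine Set.eq_univ_of_forall fun x => ?_
    obtain ⟨w, rfl⟩ := Submodule.Quotient.mk_surjective _ x
    let B := LinearMap.range (barD (SG g) 2) ⊔
      Submodule.span (ZMod 2) {squaresChain (surfGens g)}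
    have hw : B.mkQ w = 0 := by
      refine map_eq_zero_of_cycle B.mkQ (fun v => ?_) ?_ w.2
      · exact (Submodule.Quotient.mk_eq_zero _).2 (Submodule.mem_sup_left ⟨v, rfl⟩)
      · exact (Submodule.Quotient.mk_eq_zero _).2
          (Submodule.mem_sup_right (Submodule.mem_span_singleton_self _))
    obtain ⟨b, hb, c, hc, hbc⟩ := Submodule.mem_sup.1 ((Submodule.Quotient.mk_eq_zero _).1 hw)
    obtain ⟨t, rfl⟩ := Submodule.mem_span_singleton.1 hc
    have ht : ∀ t : ZMod 2, t = 0 ∨ t = 1 := by decide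
    rcases ht t with rfl | rfl
    · left
      rw [Submodule.Quotient.mk_eq_zero, Submodule.mem_comap, Submodule.subtype_apply, ← hbc]
      simpa using hb
    · right
      rw [Set.mem_singleton_iff, Submodule.Quotient.eq, Submodule.mem_comap,
        Submodule.subtype_apply, Submodule.coe_sub, ← hbc]
      simpa [z] using hb
end

section
/- The fourth group homology H₄(G×G; ℤ₂) with trivial ℤ₂-coefficients has exactly two elements, i.e. H₄(G×G; ℤ₂) ≅ ℤ₂. -/
set_option maxSynthPendingDepth 5

/-- Fourth group homology with trivial `ℤ₂`-coefficients (4-cycles modulo 4-boundaries). -/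
noncomputable def barH4 (π : Type) [Group π] :=
  LinearMap.ker (barD π 3) ⧸
    (Submodule.comap (LinearMap.ker (barD π 3)).subtype (LinearMap.range (barD π 4)))

/-- `IsPolyInfiniteCyclic n π` says that `π` has a subnormal series of length `n` all of whose
successive quotients are infinite cyclic. -/
inductive IsPolyInfiniteCyclic : ℕ → (π : Type) → [Group π] → Prop
  | of_subsingleton (π : Type) [Group π] [Subsingleton π] : IsPolyInfiniteCyclic 0 π
  | of_ker {n : ℕ} (π : Type) [Group π] (φ : π →* Multiplicative ℤ)
      (hφ : Function.Surjective φ) (h : IsPolyInfiniteCyclic n φ.ker) :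
      IsPolyInfiniteCyclic (n + 1) π

namespace IsPolyInfiniteCyclic

theorem of_mulEquiv {n : ℕ} {π : Type} [Group π] (h : IsPolyInfiniteCyclic n π) :
    ∀ {π' : Type} [Group π'], π' ≃* π → IsPolyInfiniteCyclic n π' := by
  induction h with
  | of_subsingleton π =>
    intro π' _ e
    have := e.toEquiv.subsingleton
    exact of_subsingleton π'
  | of_ker π φ hφ _ ih =>
    intro π' _ e
    refine of_ker π' (φ.comp e.toMonoidHom) (hφ.comp e.surjective) (ih ?_)
    exact (e.subgroupMap _).trans <| MulEquiv.subgroupCongr <| by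
      ext g
      simp [Subgroup.mem_map, MonoidHom.mem_ker]

theorem prod {m n : ℕ} {A B : Type} [Group A] [Group B] (hA : IsPolyInfiniteCyclic m A)
    (hB : IsPolyInfiniteCyclic n B) : IsPolyInfiniteCyclic (m + n) (A × B) := by
  induction hA with
  | of_subsingleton A =>
    have : Unique A := ⟨⟨1⟩, fun _ => Subsingleton.elim _ _⟩
    rw [Nat.zero_add]
    exact hB.of_mulEquiv MulEquiv.uniqueProd
  | of_ker A φ hφ _ ih =>
    rw [Nat.add_right_comm]
    refine of_ker _ (φ.comp (MonoidHom.fst A B)) (hφ.comp Prod.fst_surjective) (ih.of_mulEquiv ?_)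
    exact
      { toFun := fun g => (⟨g.1.1, g.2⟩, g.1.2)
        invFun := fun g => ⟨(g.1.1, g.2), g.1.2⟩
        left_inv := fun _ => rfl
        right_inv := fun _ => rfl
        map_mul' := fun _ _ => rfl }

theorem semidirectProduct {n : ℕ} {N : Type} [Group N] (hN : IsPolyInfiniteCyclic n N)
    (ψ : Multiplicative ℤ →* MulAut N) :
    IsPolyInfiniteCyclic (n + 1) (N ⋊[ψ] Multiplicative ℤ) := by
  refine of_ker _ SemidirectProduct.rightHom SemidirectProduct.rightHom_surjective
    (hN.of_mulEquiv ?_)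
  exact ((MonoidHom.ofInjective (SemidirectProduct.inl_injective (φ := ψ))).trans
    (MulEquiv.subgroupCongr SemidirectProduct.range_inl_eq_ker_rightHom)).symm

theorem int : IsPolyInfiniteCyclic 1 (Multiplicative ℤ) := by
  refine of_ker _ (MonoidHom.id _) Function.surjective_id ?_
  rw [MonoidHom.ker_id]
  exact of_subsingleton _

end IsPolyInfiniteCyclic

/-- The action of `ℤ` on `ℤ` in which the generator acts by negation. -/
def intSignAction : Multiplicative ℤ →* MulAut (Multiplicative ℤ) :=
  zpowersHom _ (MulEquiv.inv _)

theorem intSignAction_relation :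
    (SemidirectProduct.inl (.ofAdd 1) * SemidirectProduct.inr (.ofAdd 1) *
      SemidirectProduct.inl (.ofAdd 1) * (SemidirectProduct.inr (.ofAdd 1))⁻¹ :
      Multiplicative ℤ ⋊[intSignAction] Multiplicative ℤ) = 1 := by
  rfl

theorem conj_kx_zpow (n a : Multiplicative ℤ) :
    zpowersHom KG ky (intSignAction n a) =
      MulAut.conj (zpowersHom KG kx n) (zpowersHom KG ky a) := by
  have hx : MulAut.conj kx ky = ky⁻¹ := by
    rw [MulAut.conj_apply, mul_inv_eq_iff_eq_mul, eq_inv_mul_iff_mul_eq, ← mul_assoc]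
    exact ky_mul_kx_mul_ky
  have hgen (a : Multiplicative ℤ) :
      zpowersHom KG ky a⁻¹ = MulAut.conj kx (zpowersHom KG ky a) := by
    simp [map_zpow, hx]
  have hinv (a : Multiplicative ℤ) :
      zpowersHom KG ky a⁻¹ = (MulAut.conj kx)⁻¹ (zpowersHom KG ky a) := by
    rw [MulAut.inv_apply, MulEquiv.eq_symm_apply, ← hgen, inv_inv]
  induction n using Multiplicative.rec with
  | ofAdd n =>
  induction n using Int.induction_on generalizing a with
  | zero => simp
  | succ n ih =>
    rw [ofAdd_add, map_mul, map_mul, map_mul, MulAut.mul_apply, MulAut.mul_apply, ih]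
    exact congrArg _ (by simpa [intSignAction] using hgen a)
  | pred n ih =>
    rw [sub_eq_add_neg, ofAdd_add, map_mul, map_mul, map_mul, MulAut.mul_apply, MulAut.mul_apply,
      ih]
    exact congrArg _ (by simpa [intSignAction] using hinv a)

/-- The Klein bottle group is the nontrivial semidirect product `ℤ ⋊ ℤ`. -/
noncomputable def kleinEquiv :
    KG ≃* Multiplicative ℤ ⋊[intSignAction] Multiplicative ℤ := by
  refine MonoidHom.toMulEquiv
    (PresentedGroup.toGroup (f := ![SemidirectProduct.inr (Multiplicative.ofAdd 1),
      SemidirectProduct.inl (Multiplicative.ofAdd 1)]) ?_)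
    (SemidirectProduct.lift (zpowersHom _ ky) (zpowersHom _ kx) ?_) ?_ ?_
  · rintro r rfl
    simp only [map_mul, map_inv, FreeGroup.lift_apply_of]
    exact intSignAction_relation
  · intro g
    exact MonoidHom.ext (conj_kx_zpow g)
  · ext i
    fin_cases i <;> simp [kx, ky]
  · apply SemidirectProduct.hom_ext <;> ext <;> simp [kx, ky]

theorem isPolyInfiniteCyclic_klein : IsPolyInfiniteCyclic 2 KG :=
  (IsPolyInfiniteCyclic.int.semidirectProduct intSignAction).of_mulEquiv kleinEquiv

open CategoryTheory CategoryTheory.Limits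

/-- The trivial representation of `π` on `ℤ₂`. -/
noncomputable abbrev trivRep (π : Type) [Group π] : Rep (ZMod 2) π :=
  Rep.trivial (ZMod 2) π (ZMod 2)

theorem barD_eq (π : Type) [Group π] (n : ℕ) :
    barD π n = (groupHomology.inhomogeneousChains.d (trivRep π) n).hom := by
  refine Finsupp.lhom_ext' fun g => LinearMap.ext_ring ?_
  have hlast : Fin.contractNth (Fin.last n) (· * ·) g = fun j => g j.castSucc := by
    ext j
    rw [Fin.contractNth_apply_of_lt _ _ _ _ (by simp)]
  simp [barD, groupHomology.inhomogeneousChains.d, Fin.sum_univ_castSucc, hlast, add_assoc]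

theorem card_barH4 (π : Type) [Group π] :
    Nat.card (barH4 π) = Nat.card (groupHomology (trivRep π) 4) := by
  let K := groupHomology.inhomogeneousChains (trivRep π)
  have e := (K.homologyIsoSc' 5 4 3 (by simp) (by simp) ≪≫
    (K.sc' 5 4 3).moduleCatHomologyIso).toLinearEquiv
  have h3 : (K.d 4 3).hom = barD π 3 := by
    rw [barD_eq, ← groupHomology.inhomogeneousChains.d_def]
  have h4 : (K.d 5 4).hom = barD π 4 := by
    rw [barD_eq, ← groupHomology.inhomogeneousChains.d_def]
  refine Eq.trans ?_ (Nat.card_congr e.toEquiv).symm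
  refine Nat.card_congr (Submodule.Quotient.equiv _ _ (LinearEquiv.ofEq _ _ ?_) ?_).toEquiv
  · exact congrArg LinearMap.ker h3.symm
  · ext x
    constructor
    · rintro ⟨z, ⟨y, hy⟩, rfl⟩
      refine ⟨y, Subtype.ext ?_⟩
      exact congr($h4 y).trans hy
    · rintro ⟨y, rfl⟩
      refine ⟨⟨barD π 4 y, ?_⟩, ⟨y, rfl⟩, Subtype.ext congr($h4 y).symm⟩
      rw [← h3, ← h4]
      exact congr($(K.d_comp_d 5 4 3) y)

/-- A monic endomorphism of a module with two elements is the identity. -/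
theorem hom_apply_eq_self_of_card_eq_two {R : Type} [Ring R] {M : ModuleCat.{0} R}
    (hM : Nat.card M = 2) (f : M ⟶ M) [Mono f] (x : M) : f x = x := by
  have hf := (ModuleCat.mono_iff_injective f).1 inferInstance
  by_cases hx : x = 0
  · simp [hx]
  · by_contra h
    have := (Nat.card_eq_two_iff' (0 : M)).1 hM
    exact h (this.unique ((map_ne_zero_iff f.hom hf).2 hx) hx)

/-- `Hₙ(π;ℤ₂)` has two elements and `Hₘ(π;ℤ₂)` vanishes for `m > n`. -/
structure HasTopHomology (π : Type) [Group π] (n : ℕ) : Prop where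
  card_eq : Nat.card (groupHomology (trivRep π) n) = 2
  isZero : ∀ m, n < m → IsZero (groupHomology (trivRep π) m)

theorem hasTopHomology_of_subsingleton (π : Type) [Group π] [Subsingleton π] :
    HasTopHomology π 0 where
  card_eq := by
    rw [Nat.card_congr (groupHomology.H0IsoOfIsTrivial (trivRep π)).toLinearEquiv.toEquiv]
    exact Nat.card_zmod 2
  isZero m hm := by
    obtain ⟨m, rfl⟩ := Nat.exists_eq_succ_of_ne_zero hm.ne'
    exact isZero_groupHomology_succ_of_subsingleton _ _

section Wang

variable {π : Type} [Group π] (φ : π →* Multiplicative ℤ)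

/-- The representation of `π` on `ℤ₂[ℤ]` by translations through `φ : π → ℤ`. -/
@[simps]
noncomputable def translationRep : Representation (ZMod 2) π (ℤ →₀ ZMod 2) where
  toFun g := Finsupp.lmapDomain _ _ (· - (φ g).toAdd)
  map_one' := by ext; simp
  map_mul' g h := by
    ext; simp [sub_sub, add_comm]

/-- The unit translation of `ℤ₂[ℤ]`. -/
noncomputable def shift : Rep.of (translationRep φ) ≅ Rep.of (translationRep φ) :=
  Rep.mkIso <| .mk (Finsupp.domLCongr (Equiv.addRight (1 : ℤ))) fun g => by
    ext; simp [sub_add_eq_add_sub]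

/-- The augmentation `ℤ₂[ℤ] ⟶ ℤ₂`. -/
noncomputable def augmentation : Rep.of (translationRep φ) ⟶ trivRep π :=
  Rep.ofHom ⟨Finsupp.lsum (ZMod 2) fun _ => LinearMap.id, fun g => by ext; simp⟩

/-- The difference of the unit translation and the identity. -/
noncomputable def shiftSubOne : Rep.of (translationRep φ) ⟶ Rep.of (translationRep φ) :=
  Rep.ofHom ⟨Finsupp.lmapDomain _ _ (· + 1) - LinearMap.id, fun g => by
    refine Finsupp.lhom_ext fun m a => ?_
    simp [sub_add_eq_add_sub, Finsupp.mapDomain_sub]⟩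

theorem shiftSubOne_apply (x : ℤ →₀ ZMod 2) :
    (shiftSubOne φ).hom x = x.mapDomain (· + 1) - x := rfl

theorem shiftSubOne_add_id : shiftSubOne φ + 𝟙 _ = (shift φ).hom := by
  refine Rep.hom_ext <| Representation.IntertwiningMap.ext <| Finsupp.lhom_ext fun m a => ?_
  exact (sub_add_cancel _ _).trans (by simp [shift])

/-- The short complex `ℤ₂[ℤ] ⟶ ℤ₂[ℤ] ⟶ ℤ₂` underlying the Wang sequence. -/
noncomputable abbrev wang : ShortComplex (Rep (ZMod 2) π) where
  f := shiftSubOne φ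
  g := augmentation φ
  zero := by
    refine Rep.hom_ext <| Representation.IntertwiningMap.ext <| Finsupp.lhom_ext fun m a => ?_
    simp [shiftSubOne, augmentation, Finsupp.sum_sub_index]

theorem exists_shiftSubOne_add_single (x : ℤ →₀ ZMod 2) :
    ∃ y : ℤ →₀ ZMod 2,
      (shiftSubOne φ).hom y + Finsupp.single 0 ((augmentation φ).hom x) = x := by
  induction x using Finsupp.induction_linear with
  | zero => exact ⟨0, by simp⟩
  | add x₁ x₂ h₁ h₂ =>
    obtain ⟨y₁, h₁⟩ := h₁
    obtain ⟨y₂, h₂⟩ := h₂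
    refine ⟨y₁ + y₂, ?_⟩
    conv_rhs => rw [← h₁, ← h₂]
    rw [map_add, map_add, Finsupp.single_add]
    abel
  | single m a =>
    have ha (m : ℤ) : (augmentation φ).hom (Finsupp.single m a) = a := by simp [augmentation]
    simp only [ha]
    induction m using Int.induction_on with
    | zero => exact ⟨0, by simp⟩
    | succ n ih =>
      obtain ⟨y, hy⟩ := ih
      refine ⟨y + Finsupp.single (n : ℤ) a, ?_⟩
      rw [shiftSubOne_apply] at hy ⊢
      rw [Finsupp.mapDomain_add, Finsupp.mapDomain_single, ← hy]
      abel
    | pred n ih =>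
      obtain ⟨y, hy⟩ := ih
      refine ⟨y - Finsupp.single (-(n : ℤ) - 1) a, ?_⟩
      rw [shiftSubOne_apply] at hy ⊢
      rw [Finsupp.mapDomain_sub, Finsupp.mapDomain_single, sub_add_cancel, ← hy]
      abel

theorem wang_shortExact : (wang φ).ShortExact where
  mono_f := by
    rw [Rep.mono_iff_injective]
    refine (injective_iff_map_eq_zero _).2 fun (x : ℤ →₀ ZMod 2) hx => ?_
    replace hx : x.mapDomain (· + 1) = x := sub_eq_zero.1 hx
    have h (m : ℤ) : x m = x (m + 1) := by
      conv_rhs => rw [← hx]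
      exact (Finsupp.mapDomain_apply (add_left_injective 1) x m).symm
    have h0 (m : ℤ) : x m = x 0 := by
      induction m using Int.induction_on with
      | zero => rfl
      | succ n ih => rw [← h, ih]
      | pred n ih => rw [h, sub_add_cancel, ih]
    obtain ⟨m, hm⟩ := Infinite.exists_notMem_finset x.support
    ext l
    rw [h0 l, ← h0 m]
    simpa using hm
  epi_g := by
    rw [Rep.epi_iff_surjective]
    intro a
    exact ⟨Finsupp.single 0 a, by simp [augmentation]⟩
  exact := by
    refine (ShortComplex.exact_map_iff_of_faithful _
      (forget₂ (Rep (ZMod 2) π) (ModuleCat (ZMod 2)))).1 ?_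
    rw [ShortComplex.moduleCat_exact_iff]
    intro (x : ℤ →₀ ZMod 2) hx
    obtain ⟨y, hy⟩ := exists_shiftSubOne_add_single φ x
    replace hx : (augmentation φ).hom x = 0 := hx
    refine ⟨y, ?_⟩
    rw [hx, Finsupp.single_zero, add_zero] at hy
    exact hy

/-- For surjective `φ`, the translation representation is induced from the trivial
representation of `ker φ`. -/
noncomputable def indIsoTranslation (hφ : Function.Surjective φ) :
    Rep.ind φ.ker.subtype (trivRep φ.ker) ≅ Rep.of (translationRep φ) := by
  refine Rep.mkIso (.mk (LinearEquiv.ofLinearMap (Representation.Coinvariants.lift _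
      (TensorProduct.lift <| (Finsupp.lift _ _ _ fun h => Finsupp.lsingle (φ h).toAdd) ∘ₗ
        (MonoidAlgebra.coeffLinearEquiv (ZMod 2)).toLinearMap) ?_)
      (Finsupp.lsum (ZMod 2) fun m => Representation.IndV.mk _ _ (hφ (.ofAdd m)).choose) ?_ ?_) ?_)
  · intro g
    ext h : 4
    simp [(MonoidHom.mem_ker).1 g.2]
  · ext m
    simp [(hφ _).choose_spec]
  · ext h
    have hs := (hφ (φ h)).choose_spec
    have := Representation.Coinvariants.mk_self_apply (Representation.tprod
      (MonoidHom.comp (Representation.leftRegular (ZMod 2) π) φ.ker.subtype)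
      (Representation.trivial (ZMod 2) φ.ker (ZMod 2)))
      ⟨(hφ (φ h)).choose * h⁻¹, by simp [MonoidHom.mem_ker, hs]⟩ (.single h 1 ⊗ₜ 1)
    simpa using this
  · intro g
    ext h
    simp [sub_eq_add_neg]

instance chainsFunctor_additive : (groupHomology.chainsFunctor (ZMod 2) π).Additive where
  map_add := by
    intro A B f g
    ext i : 1
    refine ModuleCat.hom_ext <| Finsupp.lhom_ext fun x a => ?_
    rw [HomologicalComplex.add_f_apply]
    refine (groupHomology.chainsMap_f_single (MonoidHom.id π) (f + g) i x a).trans ?_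
    refine Eq.trans ?_ (congrArg₂ (· + ·)
      (groupHomology.chainsMap_f_single (MonoidHom.id π) f i x a)
      (groupHomology.chainsMap_f_single (MonoidHom.id π) g i x a)).symm
    exact Finsupp.single_add _ _ _

instance functor_additive (n : ℕ) : (groupHomology.functor (ZMod 2) π n).Additive :=
  inferInstanceAs (groupHomology.chainsFunctor (ZMod 2) π ⋙
    HomologicalComplex.homologyFunctor _ _ n).Additive

/-- The Wang sequence shifts the top homology of `ker φ` up by one degree. -/
theorem hasTopHomology_succ_of_ker (hφ : Function.Surjective φ) {n : ℕ}
    (h : HasTopHomology φ.ker n) : HasTopHomology π (n + 1) := by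
  classical
  have e (m : ℕ) : groupHomology (Rep.of (translationRep φ)) m ≅ groupHomology (trivRep φ.ker) m :=
    (groupHomology.functor _ π m).mapIso (indIsoTranslation φ hφ).symm ≪≫
      groupHomology.indIso _ _ m
  have hz (m : ℕ) (hm : n < m) : IsZero (groupHomology (Rep.of (translationRep φ)) m) :=
    (h.isZero m hm).of_iso (e m)
  have hc : Nat.card (groupHomology (Rep.of (translationRep φ)) n) = 2 :=
    (Nat.card_congr (e n).toLinearEquiv.toEquiv).trans h.card_eq
  have hf : (groupHomology.functor (ZMod 2) π n).map (shiftSubOne φ) = 0 := by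
    have hadd := (groupHomology.functor (ZMod 2) π n).map_add (f := shiftSubOne φ) (g := 𝟙 _)
    rw [shiftSubOne_add_id, CategoryTheory.Functor.map_id] at hadd
    ext x
    have hx := congr($hadd x)
    rw [hom_apply_eq_self_of_card_eq_two
      (M := (groupHomology.functor (ZMod 2) π n).obj (Rep.of (translationRep φ))) hc] at hx
    exact add_eq_right.1 hx.symm
  have : Mono (groupHomology.δ (wang_shortExact φ) (n + 1) n rfl) :=
    groupHomology.mono_δ_of_isZero _ _ (hz _ n.lt_succ_self)
  have : Epi (groupHomology.δ (wang_shortExact φ) (n + 1) n rfl) :=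
    (groupHomology.mapShortComplex₁_exact (wang_shortExact φ) rfl).epi_f hf
  have := isIso_of_mono_of_epi (groupHomology.δ (wang_shortExact φ) (n + 1) n rfl)
  refine ⟨?_, fun m hm => ?_⟩
  · refine Eq.trans (Nat.card_congr ?_) hc
    exact (asIso (groupHomology.δ (wang_shortExact φ) (n + 1) n rfl)).toLinearEquiv.toEquiv
  · obtain ⟨m, rfl⟩ := Nat.exists_eq_add_of_lt (Nat.zero_lt_of_lt hm)
    rw [zero_add] at *
    have := groupHomology.mono_δ_of_isZero (wang_shortExact φ) m (hz _ (by omega))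
    exact (hz m (by omega)).of_mono (groupHomology.δ (wang_shortExact φ) (m + 1) m rfl)

end Wang

theorem IsPolyInfiniteCyclic.hasTopHomology {n : ℕ} {π : Type} [Group π]
    (h : IsPolyInfiniteCyclic n π) : HasTopHomology π n := by
  induction h with
  | of_subsingleton π => exact hasTopHomology_of_subsingleton π
  | of_ker π φ hφ _ ih => exact hasTopHomology_succ_of_ker φ hφ ih

/-- `H₄(G×G;ℤ₂)` has exactly two elements. -/
theorem stmt19 : Nat.card (barH4 (KG × KG)) = 2 := by
  rw [card_barH4]
  exact (isPolyInfiniteCyclic_klein.prod isPolyInfiniteCyclic_klein).hasTopHomology.card_eq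
end
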